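/- Let L be a Submodule of (Fin n → ℂ) with finrank ℂ L = k, and suppose there is exactly one subset I of Fin n with #I = k such that the I-th Plücker coordinate of L is nonzero. Then L is the corresponding coordinate subspace: L is the span of the standard basis vectors {e_i : i ∈ I} for that unique I. (A stratum W_σ with σ = {I} consisting of a single admissible set is a fixed point of the torus action.) -/

import Mathlib

open Module

/-- The `I`-th Plücker coordinate of a `k`-dimensional subspace `L ⊆ ℂⁿ` (`#I = k`) is nonzero
iff the coordinate projection onto the coordinates in `I` restricts to a linear isomorphism of
`L` onto `I → ℂ`, i.e. iff the corresponding `k × k` minor of a basis matrix of `L` is nonzero. -/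
def PluckerNonzero {n : ℕ} (L : Submodule ℂ (Fin n → ℂ)) (I : Finset (Fin n)) : Prop :=
  Function.Bijective ((LinearMap.funLeft ℂ ℂ (fun i : I => (i : Fin n))).comp L.subtype)

/-- A `k`-dimensional subspace of `ℂⁿ` with exactly one nonzero Plücker coordinate is the
corresponding coordinate subspace (a stratum `W_σ` with a single admissible set `σ = {I}` is a
fixed point of the torus action). -/
theorem single_plucker_coordinate_is_coordinate_subspace (n k : ℕ)
    (L : Submodule ℂ (Fin n → ℂ)) (hL : finrank ℂ L = k)
    (I : Finset (Fin n)) (hI : I.card = k) (hIL : PluckerNonzero L I)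
    (huniq : ∀ J : Finset (Fin n), J.card = k → PluckerNonzero L J → J = I) :
    L = Submodule.span ℂ ((fun i => (Pi.single i 1 : Fin n → ℂ)) '' I) := by
  have hinj : ∀ v ∈ L, (∀ i ∈ I, v i = 0) → v = 0 := by
    intro v hv h0
    have h : (⟨v, hv⟩ : L) = 0 := by
      apply hIL.1
      ext i
      simpa [LinearMap.funLeft_apply] using h0 i i.2
    exact congrArg Subtype.val h
  have he : ∀ i ∈ I, (Pi.single i 1 : Fin n → ℂ) ∈ L := by
    intro i hi
    obtain ⟨⟨b, hbL⟩, hb⟩ := hIL.2 (fun j => (Pi.single i 1 : Fin n → ℂ) j)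
    have hb' : ∀ j ∈ I, b j = (Pi.single i 1 : Fin n → ℂ) j := fun j hj => congrFun hb ⟨j, hj⟩
    have hbi : b i = 1 := by simpa using hb' i hi
    have key : ∀ j, j ∉ I → b j = 0 := by
      intro j hj
      by_contra hne
      have hcard : (insert j (I.erase i)).card = k := by
        rw [Finset.card_insert_of_notMem (fun h => hj (Finset.mem_of_mem_erase h)),
          Finset.card_erase_add_one hi, hI]
      have hJ : PluckerNonzero L (insert j (I.erase i)) := by
        have hi1 : Function.Injective ((LinearMap.funLeft ℂ ℂ
            (fun x : (insert j (I.erase i) : Finset (Fin n)) => (x : Fin n))).comp L.subtype) := by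
          rw [injective_iff_map_eq_zero]
          rintro ⟨v, hv⟩ h0
          have h0' : ∀ x ∈ insert j (I.erase i), v x = 0 := fun x hx => congrFun h0 ⟨x, hx⟩
          have hz : v - v i • b = 0 := by
            refine hinj _ (L.sub_mem hv (L.smul_mem _ hbL)) ?_
            intro x hx
            by_cases hxi : x = i
            · subst hxi
              simp [hbi]
            · have := h0' x (by simp [hxi, hx])
              simp [this, hb' x hx, hxi]
          have hj0 := congrFun hz j
          have hvj : v j = 0 := h0' j (by simp)
          have hvi : v i = 0 := by
            simpa [hvj, hne] using hj0
          have : v = 0 := by simpa [hvi] using hz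
          simpa using this
        refine ⟨hi1, ?_⟩
        refine (LinearMap.injective_iff_surjective_of_finrank_eq_finrank ?_).1 hi1
        rw [hL, Module.finrank_fintype_fun_eq_card, Fintype.card_coe, hcard]
      have hEq := huniq _ hcard hJ
      exact hj (hEq ▸ Finset.mem_insert_self _ _)
    have : b = Pi.single i 1 := by
      ext j
      by_cases hj : j ∈ I
      · exact hb' j hj
      · have hji : j ≠ i := fun h => hj (h ▸ hi)
        simp [key j hj, hji]
    exact this ▸ hbL
  apply le_antisymm
  · intro v hv
    have hz : v - ∑ i ∈ I, v i • (Pi.single i 1 : Fin n → ℂ) = 0 := by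
      refine hinj _ (L.sub_mem hv (L.sum_mem fun i hi => L.smul_mem _ (he i hi))) ?_
      intro x hx
      simp [Finset.sum_apply, Pi.single_apply, hx]
    rw [sub_eq_zero.1 hz]
    exact Submodule.sum_mem _ fun i hi =>
      Submodule.smul_mem _ _ (Submodule.subset_span ⟨i, hi, rfl⟩)
  · rw [Submodule.span_le]
    rintro _ ⟨i, hi, rfl⟩
    exact he i hi
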